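/- arXiv:2101.08063 — 4 statements merged into one kernel-verified Lean document; each statement's English description precedes it below -/
import Mathlib

section
/- Assume the graph G on V is connected. Every node C ∈ CC(f) with C ≠ V has a unique parent: there exists a unique node P ∈ CC(f) with C ⊊ P such that every node D ∈ CC(f) with C ⊊ D satisfies P ⊆ D. -/
/-- The upper level set of an image `f` at level `lam`. -/
def upper {V : Type*} (f : V → ℝ) (lam : ℝ) : Set V := {v | lam ≤ f v}

/-- `C` is a connected component of the subset `X` of the vertices of `G`:
it is the set of vertices of `X` reachable from some `v ∈ X` within the
subgraph of `G` induced on `X`. -/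
def IsCompOf {V : Type*} (G : SimpleGraph V) (X : Set V) (C : Set V) : Prop :=
  ∃ v, ∃ hv : v ∈ X, C = {u | ∃ hu : u ∈ X, (G.induce X).Reachable ⟨u, hu⟩ ⟨v, hv⟩}

/-- The set of connected components of all upper level sets of `f` (the nodes of the max-tree). -/
def CC {V : Type*} (G : SimpleGraph V) (f : V → ℝ) : Set (Set V) :=
  {C | ∃ lam : ℝ, IsCompOf G (upper f lam) C}

/-- The set of levels `lam` such that `C` is a connected component of the upper
level set of `f` at level `lam`. The altitude of `C` is the greatest element of this set. -/
def altSet {V : Type*} (G : SimpleGraph V) (f : V → ℝ) (C : Set V) : Set ℝ :=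
  {lam | IsCompOf G (upper f lam) C}

/-- `v` is a proper pixel of the node `C`: it belongs to `C` and to no strictly smaller node. -/
def ProperPixel {V : Type*} (G : SimpleGraph V) (f : V → ℝ) (C : Set V) (v : V) : Prop :=
  v ∈ C ∧ ∀ D ∈ CC G f, D ⊂ C → v ∉ D

theorem subset_of_le_of_mem {V : Type*} {G : SimpleGraph V} {f : V → ℝ} {C D : Set V}
    {lam mu : ℝ} (h : lam ≤ mu) (hC : IsCompOf G (upper f mu) C)
    (hD : IsCompOf G (upper f lam) D) {x : V} (hxC : x ∈ C) (hxD : x ∈ D) : C ⊆ D := by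
  obtain ⟨v, hv, rfl⟩ := hC
  obtain ⟨w, hw, rfl⟩ := hD
  obtain ⟨hx, hxv⟩ := hxC
  obtain ⟨hx', hxw⟩ := hxD
  rintro u ⟨hu, huv⟩
  have hsub : upper f mu ⊆ upper f lam := fun y hy => le_trans h hy
  exact ⟨hsub hu, ((huv.trans hxv.symm).map (G.induceHomOfLE hsub).toHom).trans hxw⟩

theorem subset_or_subset_of_mem_CC {V : Type*} {G : SimpleGraph V} {f : V → ℝ} {C D : Set V}
    (hC : C ∈ CC G f) (hD : D ∈ CC G f) {x : V} (hxC : x ∈ C) (hxD : x ∈ D) :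
    C ⊆ D ∨ D ⊆ C := by
  obtain ⟨mu, hC⟩ := hC
  obtain ⟨lam, hD⟩ := hD
  rcases le_total lam mu with h | h
  · exact Or.inl (subset_of_le_of_mem h hC hD hxC hxD)
  · exact Or.inr (subset_of_le_of_mem h hD hC hxD hxC)

theorem nonempty_of_mem_CC {V : Type*} {G : SimpleGraph V} {f : V → ℝ} {C : Set V}
    (hC : C ∈ CC G f) : C.Nonempty := by
  obtain ⟨_, v, hv, rfl⟩ := hC
  exact ⟨v, hv, SimpleGraph.Reachable.refl _⟩

theorem univ_mem_CC {V : Type*} [Finite V] {G : SimpleGraph V} (f : V → ℝ)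
    (hG : G.Connected) : Set.univ ∈ CC G f := by
  have := hG.nonempty
  obtain ⟨v, hv⟩ := Finite.exists_min f
  let φ : G →g G.induce (upper f (f v)) := ⟨fun u => ⟨u, hv u⟩, fun h => h⟩
  refine ⟨f v, v, hv v, Eq.symm (Set.eq_univ_of_forall fun u => ?_)⟩
  exact ⟨hv u, (hG u v).map φ⟩

/-- assume `G` is connected. Every node `C ∈ CC f` other than `V` has a
unique parent: a unique node `P` with `C ⊊ P` contained in every node strictly
containing `C`. -/
theorem exists_unique_parent
    {V : Type*} [Fintype V] [Nonempty V] (G : SimpleGraph V) (f : V → ℝ)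
    (hG : G.Connected) (C : Set V) (hC : C ∈ CC G f) (hCV : C ≠ Set.univ) :
    ∃! P : Set V, P ∈ CC G f ∧ C ⊂ P ∧ ∀ D ∈ CC G f, C ⊂ D → P ⊆ D := by
  obtain ⟨P, ⟨hP, hCP⟩, hmin⟩ := (Set.toFinite {D | D ∈ CC G f ∧ C ⊂ D}).exists_minimal
    ⟨Set.univ, univ_mem_CC f hG, Set.ssubset_univ_iff.mpr hCV⟩
  refine ⟨P, ⟨hP, hCP, fun D hD hCD => ?_⟩, fun Q ⟨hQ, hCQ, hQmin⟩ => ?_⟩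
  · obtain ⟨x, hx⟩ := nonempty_of_mem_CC hC
    rcases subset_or_subset_of_mem_CC hP hD (hCP.subset hx) (hCD.subset hx) with h | h
    · exact h
    · exact hmin ⟨hD, hCD⟩ h
  · have hQP := hQmin P hP hCP
    exact hQP.antisymm (hmin ⟨hQ, hCQ⟩ hQP)
end

section
/- A node C ∈ CC(f) is a leaf (i.e., no node D ∈ CC(f) satisfies D ⊊ C) if and only if C is a regional maximum of f, i.e., f is constant on C and every pixel u ∉ C adjacent in G to some pixel of C satisfies f(u) < f(v) for v ∈ C. In particular, the leaf nodes of CC(f) are in bijection with the regional maxima of f. -/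
/-- A regional maximum of `f`: a nonempty connected subset `M` on which `f` is constant
and such that every pixel outside `M` adjacent to a pixel of `M` has a strictly smaller
value. -/
def RegionalMax {V : Type*} (G : SimpleGraph V) (f : V → ℝ) (M : Set V) : Prop :=
  (G.induce M).Connected ∧
  (∀ u ∈ M, ∀ w ∈ M, f u = f w) ∧
  (∀ u ∉ M, ∀ v ∈ M, G.Adj u v → f u < f v)

/-- A set which no edge of `G` leaves inside `X` is stable under reachability inside `X`. -/
theorem mem_of_reachable_induce_of_not_adj {V : Type*} {G : SimpleGraph V} {X C : Set V}
    (hC : ∀ u ∈ X, u ∉ C → ∀ v ∈ C, ¬ G.Adj u v) {a b : X}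
    (h : (G.induce X).Reachable a b) (hb : b.1 ∈ C) : a.1 ∈ C := by
  rw [SimpleGraph.reachable_iff_reflTransGen] at h
  induction h using Relation.ReflTransGen.head_induction_on with
  | refl => exact hb
  | @head a c hac _ ih => exact by_contra fun hn => hC a a.2 hn c ih hac

/-- A preconnected subset of `X` meeting a set `C` which no edge of `G` leaves inside `X`
is contained in `C`. -/
theorem subset_of_preconnected_of_not_adj {V : Type*} {G : SimpleGraph V} {X C S : Set V}
    (hS : (G.induce S).Preconnected) (hSX : S ⊆ X)
    (hC : ∀ u ∈ X, u ∉ C → ∀ v ∈ C, ¬ G.Adj u v) {w : V} (hwS : w ∈ S) (hwC : w ∈ C) :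
    S ⊆ C := fun u hu =>
  mem_of_reachable_induce_of_not_adj (fun x hx => hC x (hSX hx)) (hS ⟨u, hu⟩ ⟨w, hwS⟩) hwC

/-- The components of `X` are the connected subsets of `X` which no edge leaves inside `X`. -/
theorem isCompOf_iff {V : Type*} {G : SimpleGraph V} {X C : Set V} :
    IsCompOf G X C ↔ C ⊆ X ∧ (G.induce C).Connected ∧
      ∀ u ∈ X, u ∉ C → ∀ v ∈ C, ¬ G.Adj u v := by
  constructor
  · rintro ⟨v, hv, rfl⟩
    refine ⟨fun u hu => hu.1, ?_, ?_⟩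
    · have hmem : v ∈ {u | ∃ hu : u ∈ X, (G.induce X).Reachable ⟨u, hu⟩ ⟨v, hv⟩} := ⟨hv, .rfl⟩
      refine SimpleGraph.connected_iff_exists_forall_reachable _ |>.2 ⟨⟨v, hmem⟩, ?_⟩
      suffices h : ∀ a : X, (G.induce X).Reachable a ⟨v, hv⟩ →
          ∀ ha : a.1 ∈ {u | ∃ hu : u ∈ X, (G.induce X).Reachable ⟨u, hu⟩ ⟨v, hv⟩},
            (G.induce _).Reachable ⟨a.1, ha⟩ ⟨v, hmem⟩ from
        fun ⟨u, hu⟩ => (h ⟨u, hu.1⟩ hu.2 hu).symm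
      intro a ha
      rw [SimpleGraph.reachable_iff_reflTransGen] at ha
      induction ha using Relation.ReflTransGen.head_induction_on with
      | refl => exact fun _ => .rfl
      | @head a c hac hc ih =>
        intro ha
        have hcm : c.1 ∈ {u | ∃ hu : u ∈ X, (G.induce X).Reachable ⟨u, hu⟩ ⟨v, hv⟩} :=
          ⟨c.2, (SimpleGraph.reachable_iff_reflTransGen _ _).2 hc⟩
        refine SimpleGraph.Reachable.trans (v := ⟨c.1, hcm⟩) ?_ (ih hcm)
        exact SimpleGraph.Adj.reachable (by simpa using hac)
    · rintro u hu hun w ⟨hw, hwv⟩ huw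
      have hadj : (G.induce X).Adj ⟨u, hu⟩ ⟨w, hw⟩ := huw
      exact hun ⟨hu, hadj.reachable.trans hwv⟩
  · rintro ⟨hCX, hconn, hadj⟩
    obtain ⟨⟨v, hv⟩⟩ := hconn.nonempty
    refine ⟨v, hCX hv, Set.Subset.antisymm (fun u hu => ⟨hCX hu, ?_⟩) ?_⟩
    · exact (hconn.preconnected ⟨u, hu⟩ ⟨v, hv⟩).map (SimpleGraph.induceHomOfLE G hCX).toHom
    · exact fun u ⟨_, h⟩ => mem_of_reachable_induce_of_not_adj hadj h hv

theorem exists_isCompOf_mem {V : Type*} (G : SimpleGraph V) {X : Set V} {v : V} (hv : v ∈ X) :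
    ∃ C, IsCompOf G X C ∧ v ∈ C :=
  ⟨_, ⟨v, hv, rfl⟩, hv, .rfl⟩

theorem RegionalMax.mem_CC {V : Type*} {G : SimpleGraph V} {f : V → ℝ} {M : Set V}
    (hM : RegionalMax G f M) : M ∈ CC G f := by
  obtain ⟨hconn, hconst, hlt⟩ := hM
  obtain ⟨⟨v, hv⟩⟩ := hconn.nonempty
  refine ⟨f v, isCompOf_iff.2 ⟨fun u hu => (hconst v hv u hu).le, hconn, ?_⟩⟩
  intro u hu hun w hw huw
  exact absurd (hlt u hun w hw huw) (not_lt.2 ((hconst w hw v hv).trans_le hu))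

theorem RegionalMax.not_exists_ssubset {V : Type*} {G : SimpleGraph V} {f : V → ℝ} {M : Set V}
    (hM : RegionalMax G f M) : ¬ ∃ D ∈ CC G f, D ⊂ M := by
  rintro ⟨D, ⟨μ, hD⟩, hDM⟩
  obtain ⟨hDX, hDconn, hDadj⟩ := isCompOf_iff.1 hD
  obtain ⟨⟨x, hx⟩⟩ := hDconn.nonempty
  refine hDM.2 (subset_of_preconnected_of_not_adj hM.1.preconnected (fun u hu => ?_) hDadj
    (hDM.1 hx) hx)
  exact (hDX hx).trans_eq (hM.2.1 x (hDM.1 hx) u hu)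

theorem regionalMax_of_not_exists_ssubset {V : Type*} [Finite V] {G : SimpleGraph V} {f : V → ℝ}
    {C : Set V} (hC : C ∈ CC G f) (hleaf : ¬ ∃ D ∈ CC G f, D ⊂ C) : RegionalMax G f C := by
  obtain ⟨lam, hC⟩ := hC
  obtain ⟨hCX, hconn, hadj⟩ := isCompOf_iff.1 hC
  obtain ⟨w, hw, hmax⟩ := C.toFinite.exists_maximalFor f C (Set.nonempty_coe_sort.1 hconn.nonempty)
  have hle : ∀ u ∈ C, f u ≤ f w := fun u hu =>
    (le_total (f u) (f w)).elim id fun h => hmax hu h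
  obtain ⟨D, hD, hwD⟩ := exists_isCompOf_mem G (X := upper f (f w)) (v := w) (le_refl (f w))
  obtain ⟨hDX, hDconn, -⟩ := isCompOf_iff.1 hD
  have hupper : upper f (f w) ⊆ upper f lam := fun u hu =>
    show lam ≤ f u from le_trans (hCX hw) hu
  have hDC : D ⊆ C := subset_of_preconnected_of_not_adj
    hDconn.preconnected (hDX.trans hupper) hadj hwD hw
  have hCD : C ⊆ D := by_contra fun h => hleaf ⟨D, ⟨_, hD⟩, hDC, h⟩
  have heq : ∀ u ∈ C, f u = f w := fun u hu => (hle u hu).antisymm (hDX (hCD hu))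
  refine ⟨hconn, fun u hu v hv => (heq u hu).trans (heq v hv).symm, fun u hu v hv huv => ?_⟩
  exact lt_of_not_ge fun h => hadj u ((hCX hv).trans h) hu v hv huv

/-- a node `C ∈ CC f` is a leaf (no node is strictly contained in it) iff
`C` is a regional maximum of `f`; in particular, the leaf nodes of `CC f` are exactly
(hence in bijection with) the regional maxima of `f`. -/
theorem leaf_iff_regionalMax
    {V : Type*} [Fintype V] [Nonempty V] (G : SimpleGraph V) (f : V → ℝ) :
    (∀ C ∈ CC G f, ((¬ ∃ D ∈ CC G f, D ⊂ C) ↔ RegionalMax G f C)) ∧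
    {C | C ∈ CC G f ∧ ¬ ∃ D ∈ CC G f, D ⊂ C} = {M | RegionalMax G f M} := by
  exact ⟨fun C hC => ⟨regionalMax_of_not_exists_ssubset hC, fun h => h.not_exists_ssubset⟩,
    Set.ext fun _ => ⟨fun h => regionalMax_of_not_exists_ssubset h.1 h.2,
      fun h => ⟨RegionalMax.mem_CC h, RegionalMax.not_exists_ssubset h⟩⟩⟩
end

section
/- (Proposition 1) Let f : V → ℝ be an image and ε : V → ℝ a perturbation such that CC(f) = CC(f + ε) (the hierarchies of the max-trees of f and f + ε coincide). Then for every node C ∈ CC(f), the altitude of C with respect to f + ε equals alt_f(C) + ε(v) for any proper pixel v of C (with respect to f). -/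
/-- The altitude of a node is the value of the image at any of its proper pixels. -/
theorem ProperPixel.eq_of_isGreatest {V : Type*} {G : SimpleGraph V} {f : V → ℝ} {C : Set V}
    {v : V} {a : ℝ} (hv : ProperPixel G f C v) (ha : IsGreatest (altSet G f C) a) :
    f v = a := by
  obtain ⟨hvC, hmin⟩ := hv
  obtain ⟨w, hw, hCw⟩ := ha.1
  obtain ⟨hva, hvw⟩ : ∃ hu : v ∈ upper f a,
      (G.induce (upper f a)).Reachable ⟨v, hu⟩ ⟨w, hw⟩ := by
    rw [hCw] at hvC
    exact hvC
  have hle : upper f (f v) ≤ upper f a := fun u (hu : f v ≤ f u) => (show a ≤ f v from hva).trans hu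
  have hvv : v ∈ upper f (f v) := le_refl (f v)
  let D : Set V := {u | ∃ hu : u ∈ upper f (f v),
    (G.induce (upper f (f v))).Reachable ⟨u, hu⟩ ⟨v, hvv⟩}
  have hD : IsCompOf G (upper f (f v)) D := ⟨v, hvv, rfl⟩
  have hDC : D ⊆ C := by
    rintro u ⟨hu, huv⟩
    rw [hCw]
    exact ⟨hle hu, (huv.map (SimpleGraph.induceHomOfLE G hle).toHom).trans hvw⟩
  have hEq : D = C := by
    by_contra hne
    exact hmin D ⟨f v, hD⟩ (hDC.ssubset_of_ne hne) ⟨hvv, .refl _⟩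
  exact le_antisymm (ha.2 (hEq ▸ hD)) hva

/-- Proposition 1: if `ε` is a perturbation such that the max-trees of
`f` and `f + ε` have the same hierarchy (`CC f = CC (f + ε)`), then for every node
`C ∈ CC f`, the altitude of `C` with respect to `f + ε` equals the altitude of `C`
with respect to `f` plus `ε v`, for any proper pixel `v` of `C` with respect to `f`. -/
theorem altitude_perturbation
    {V : Type*} [Fintype V] [Nonempty V] (G : SimpleGraph V) (f ε : V → ℝ)
    (hcc : CC G f = CC G (f + ε)) (C : Set V) (hC : C ∈ CC G f)
    (a a' : ℝ) (ha : IsGreatest (altSet G f C) a) (ha' : IsGreatest (altSet G (f + ε) C) a')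
    (v : V) (hv : ProperPixel G f C v) :
    a' = a + ε v := by
  have hv' : ProperPixel G (f + ε) C v := ⟨hv.1, hcc ▸ hv.2⟩
  rw [← hv.eq_of_isGreatest ha, ← hv'.eq_of_isGreatest ha', Pi.add_apply]
end

section
/- Let f : V → ℝ be an image and ε : V → ℝ a perturbation such that CC(f) = CC(f + ε). Then for every node C ∈ CC(f), ε is constant on the set of proper pixels of C with respect to f: any two proper pixels v, w of C satisfy ε(v) = ε(w). -/
theorem upper_antitone {V : Type*} (f : V → ℝ) : Antitone (upper f) :=
  fun _ _ h _ hv => le_trans h hv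

theorem IsCompOf.subset {V : Type*} {G : SimpleGraph V} {X C : Set V} (hC : IsCompOf G X C) :
    C ⊆ X := by
  obtain ⟨v, hv, rfl⟩ := hC
  exact fun u hu => hu.1

/-- If `w` lies in the component `C` of `X`, then every vertex reachable from `w` within a subset
of `X` lies in `C`. -/
theorem IsCompOf.mem_of_reachable {V : Type*} {G : SimpleGraph V} {X Y C : Set V}
    (hC : IsCompOf G X C) (hYX : Y ⊆ X) {u w : V} (hwC : w ∈ C) {hu : u ∈ Y} {hw : w ∈ Y}
    (h : (G.induce Y).Reachable ⟨u, hu⟩ ⟨w, hw⟩) : u ∈ C := by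
  obtain ⟨r, hr, rfl⟩ := hC
  obtain ⟨hwX, hwr⟩ := hwC
  exact ⟨hYX hu, (h.map (G.induceHomOfLE hYX).toHom).trans hwr⟩

theorem ProperPixel.le {V : Type*} {G : SimpleGraph V} {f : V → ℝ} {C : Set V} {v w : V}
    (hC : C ∈ CC G f) (hv : v ∈ C) (hw : ProperPixel G f C w) : f w ≤ f v := by
  by_contra! hlt
  obtain ⟨lam, hlam⟩ := hC
  have hlv : lam ≤ f v := hlam.subset hv
  have hww : w ∈ upper f (f w) := le_refl (f w)
  refine hw.2 _ ⟨f w, w, hww, rfl⟩ ⟨?_, ?_⟩ ⟨hww, .rfl⟩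
  · rintro u ⟨hu, hreach⟩
    exact hlam.mem_of_reachable (upper_antitone f (hlv.trans hlt.le)) hw.1 hreach
  · intro hsub
    obtain ⟨hvw, -⟩ := hsub hv
    exact hlt.not_ge hvw

theorem ProperPixel.eq {V : Type*} {G : SimpleGraph V} {f : V → ℝ} {C : Set V} {v w : V}
    (hC : C ∈ CC G f) (hv : ProperPixel G f C v) (hw : ProperPixel G f C w) : f v = f w :=
  le_antisymm (hv.le hC hw.1) (hw.le hC hv.1)

theorem ProperPixel.congr {V : Type*} {G : SimpleGraph V} {f g : V → ℝ} {C : Set V} {v : V}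
    (h : CC G f = CC G g) (hv : ProperPixel G f C v) : ProperPixel G g C v :=
  ⟨hv.1, h ▸ hv.2⟩

/-- if `ε` is a perturbation such that `CC f = CC (f + ε)`, then for every
node `C ∈ CC f`, `ε` is constant on the proper pixels of `C` with respect to `f`. -/
theorem perturbation_const_on_properPixels
    {V : Type*} [Fintype V] [Nonempty V] (G : SimpleGraph V) (f ε : V → ℝ)
    (hcc : CC G f = CC G (f + ε)) (C : Set V) (hC : C ∈ CC G f)
    (v w : V) (hv : ProperPixel G f C v) (hw : ProperPixel G f C w) :
    ε v = ε w := by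
  have hf : f v = f w := hv.eq hC hw
  have hg : (f + ε) v = (f + ε) w := (hv.congr hcc).eq (hcc ▸ hC) (hw.congr hcc)
  simpa [hf] using hg
end
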